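/- Let f_1,…,f_m ∈ ℝ[x_1,…,x_n] and let σ = (σ_1,…,σ_m) ∈ {≤, <, =, >, ≥}^m. Set E_σ = {i : σ_i is '='}. Let C be a connected component of the set {x ∈ ℝⁿ : f_1(x) σ_1 0, …, f_m(x) σ_m 0} and let z ∈ Z(C). Then the set S_0 = {i ∈ {1,…,m} : f_i(z) = 0} is nonempty, E_σ ⊆ S_0, and if the cardinality of S_0 is at most n−1, then the truncated gradient vectors ∇̄f_i(z) := (∂f_i/∂x_2(z), …, ∂f_i/∂x_n(z)) ∈ ℝ^{n−1}, for i ∈ S_0, are linearly dependent over ℝ. -/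

import Mathlib

open MvPolynomial Set

/-- A sign symbol among `≤, <, =, >, ≥`. -/
inductive Sign5 | le | lt | eq | gt | ge

/-- The relation "`t σ 0`" for a sign symbol `σ`. -/
def Sign5.holds : Sign5 → ℝ → Prop
  | .le, t => t ≤ 0
  | .lt, t => t < 0
  | .eq, t => t = 0
  | .gt, t => 0 < t
  | .ge, t => 0 ≤ t

/-- The projection `π_1` of a subset of `ℝⁿ` to its first coordinate. -/
def proj1 {n : ℕ} (hn : 0 < n) (A : Set (Fin n → ℝ)) : Set ℝ := (fun x => x ⟨0, hn⟩) '' A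

/-- `Z_inf(A)` with respect to the first coordinate. -/
def Zinf {n : ℕ} (hn : 0 < n) (A : Set (Fin n → ℝ)) : Set (Fin n → ℝ) :=
  {x | x ∈ closure A ∧ BddBelow (proj1 hn A) ∧ x ⟨0, hn⟩ = sInf (proj1 hn A)}

/-- `Z_sup(A)` with respect to the first coordinate. -/
def Zsup {n : ℕ} (hn : 0 < n) (A : Set (Fin n → ℝ)) : Set (Fin n → ℝ) :=
  {x | x ∈ closure A ∧ BddAbove (proj1 hn A) ∧ x ⟨0, hn⟩ = sSup (proj1 hn A)}

/-- `Z(A) = Z_inf(A) ∪ Z_sup(A)`. -/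
def ZZ {n : ℕ} (hn : 0 < n) (A : Set (Fin n → ℝ)) : Set (Fin n → ℝ) :=
  Zinf hn A ∪ Zsup hn A

theorem MvPolynomial.hasStrictFDerivAt_eval {ι : Type*} [Fintype ι] (p : MvPolynomial ι ℝ)
    (z : ι → ℝ) :
    HasStrictFDerivAt (fun x : ι → ℝ => eval x p)
      (∑ k, eval z (pderiv k p) • ContinuousLinearMap.proj (R := ℝ) (φ := fun _ : ι => ℝ) k) z := by
  classical
  induction p using MvPolynomial.induction_on with
  | C a => simpa using hasStrictFDerivAt_const (𝕜 := ℝ) a z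
  | add p q hp hq =>
    simp only [map_add, add_smul, Finset.sum_add_distrib]
    exact hp.add hq
  | mul_X p j hp =>
    simp only [map_mul, eval_X]
    refine (hp.mul (hasStrictFDerivAt_apply j z)).congr_fderiv ?_
    ext v
    simp [pderiv_X, Pi.single_apply, apply_ite (eval z), Finset.sum_add_distrib, add_mul,
      Finset.mul_sum, mul_assoc]

theorem Matrix.mulVec_surjective_of_linearIndependent_row {ι κ K : Type*} [Field K] [Fintype ι]
    [Fintype κ] {A : Matrix ι κ K} (hA : LinearIndependent K A.row) :
    Function.Surjective A.mulVec := by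
  have h : LinearMap.range A.mulVecLin = ⊤ := by
    apply Submodule.eq_top_of_finrank_eq
    rw [Module.finrank_fintype_fun_eq_card]
    exact hA.rank_matrix
  exact LinearMap.range_eq_top.mp h

/-- A connected component of a set which, near a point `z` of its closure, is the preimage of a
convex set under the second component of a submersion `G`, attains every value of the first
component of `G` close to its value at `z`. -/
theorem HasStrictFDerivAt.eventually_exists_mem_connectedComponentIn
    {E F : Type*} [NormedAddCommGroup E] [NormedSpace ℝ E] [FiniteDimensional ℝ E]
    [NormedAddCommGroup F] [NormedSpace ℝ F] [FiniteDimensional ℝ F]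
    {G : E → ℝ × F} {G' : E →L[ℝ] ℝ × F} {z x₀ : E} {S U : Set E} {Q : Set F}
    (hG : HasStrictFDerivAt G G' z) (hG' : Function.Surjective G') (hQ : Convex ℝ Q)
    (hU : U ∈ nhds z) (hSQ : ∀ x ∈ S, (G x).2 ∈ Q) (hUS : ∀ x ∈ U, (G x).2 ∈ Q → x ∈ S)
    (hz : z ∈ closure (connectedComponentIn S x₀)) :
    ∀ᶠ t in nhds (G z).1, ∃ x ∈ connectedComponentIn S x₀, (G x).1 = t := by
  have hrange : G'.range = ⊤ := LinearMap.range_eq_top.mpr hG'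
  let e := hG.implicitToOpenPartialHomeomorph G G' hrange
  have he (x : E) : (e x).1 = G x := hG.implicitToOpenPartialHomeomorph_fst hrange x
  have hzs : z ∈ e.source := hG.mem_implicitToOpenPartialHomeomorph_source hrange
  have hnhds : e.target ∩ e.symm ⁻¹' U ∈ nhds (e z) :=
    Filter.inter_mem (e.open_target.mem_nhds (e.map_source hzs))
      (e.tendsto_symm hzs hU)
  obtain ⟨ε, hε, hball⟩ := Metric.mem_nhds_iff.mp hnhds
  obtain ⟨c, ⟨hcs, hcb⟩, hcC⟩ := mem_closure_iff_nhds.mp hz _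
    (Filter.inter_mem (e.open_source.mem_nhds hzs)
      ((e.continuousAt hzs).preimage_mem_nhds (Metric.ball_mem_nhds _ hε)))
  have hcS : c ∈ S := connectedComponentIn_subset S x₀ hcC
  let T := Metric.ball (e z) ε ∩ {y | y.1.2 ∈ Q}
  have hGsymm {y} (hy : y ∈ T) : G (e.symm y) = y.1 := by
    rw [← he, e.right_inv (hball hy.1).1]
  have hT : Convex ℝ T := (convex_ball _ _).inter
    (hQ.linear_preimage ((LinearMap.snd ℝ ℝ F).comp (LinearMap.fst ℝ (ℝ × F) G'.ker)))
  have hcT : e c ∈ T := ⟨hcb, by simpa only [mem_ofPred_eq, he] using hSQ c hcS⟩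
  have hTC : e.symm '' T ⊆ connectedComponentIn S x₀ := by
    rw [connectedComponentIn_eq hcC]
    refine IsPreconnected.subset_connectedComponentIn (hT.isPreconnected.image _
      (e.continuousOn_symm.mono fun y hy => (hball hy.1).1)) ⟨e c, hcT, e.left_inv hcs⟩ ?_
    rintro _ ⟨y, hy, rfl⟩
    exact hUS _ (hball hy.1).2 (by rw [hGsymm hy]; exact hy.2)
  filter_upwards [Metric.ball_mem_nhds _ hε] with t ht
  have htT : ((t, (e c).1.2), (e c).2) ∈ T := by
    refine ⟨?_, hcT.2⟩
    have hcb' : dist (e c) (e z) < ε := hcb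
    simp only [Prod.dist_eq, max_lt_iff, Metric.mem_ball] at hcb' ht ⊢
    exact ⟨⟨by simpa only [he] using ht, hcb'.1.2⟩, hcb'.2⟩
  exact ⟨_, hTC (mem_image_of_mem _ htT), by rw [hGsymm htT]⟩

theorem Sign5.convex_holds (s : Sign5) : Convex ℝ {t | s.holds t} := by
  cases s
  · exact convex_Iic 0
  · exact convex_Iio 0
  · exact convex_singleton 0
  · exact convex_Ioi 0
  · exact convex_Ici 0

theorem Sign5.eventually_holds_of_ne_zero {s : Sign5} {a : ℝ} (ha : a ≠ 0)
    (hs : a ∈ closure {t | s.holds t}) : ∀ᶠ t in nhds a, s.holds t := by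
  cases s
  · exact (eventually_lt_nhds (lt_of_le_of_ne (isClosed_Iic.closure_subset hs) ha)).mono
      fun _ => le_of_lt
  · exact eventually_lt_nhds
      (lt_of_le_of_ne (closure_minimal Iio_subset_Iic_self isClosed_Iic hs) ha)
  · exact absurd (isClosed_singleton.closure_subset hs) ha
  · exact eventually_gt_nhds
      (lt_of_le_of_ne (closure_minimal Ioi_subset_Ici_self isClosed_Ici hs) ha.symm)
  · exact (eventually_gt_nhds (lt_of_le_of_ne (isClosed_Ici.closure_subset hs) ha.symm)).mono
      fun _ => le_of_lt

theorem notMem_ZZ_of_eventually {n : ℕ} {hn : 0 < n} {A : Set (Fin n → ℝ)} {z : Fin n → ℝ}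
    (h : ∀ᶠ t in nhds (z ⟨0, hn⟩), ∃ x ∈ A, x ⟨0, hn⟩ = t) : z ∉ ZZ hn A := by
  obtain ⟨ε, hε, hball⟩ := Metric.eventually_nhds_iff_ball.mp h
  rintro (⟨-, hb, hz⟩ | ⟨-, hb, hz⟩)
  · have hle := csInf_le hb (hball (z ⟨0, hn⟩ - ε / 2) (by simp [abs_of_pos hε, hε]))
    rw [← hz] at hle
    linarith
  · have hle := le_csSup hb (hball (z ⟨0, hn⟩ + ε / 2) (by simp [abs_of_pos hε, hε]))
    rw [← hz] at hle
    linarith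

theorem surjective_proj_prod_of_linearIndependent {n : ℕ} (hn : 0 < n) {ι : Type*} [Fintype ι]
    (a : ι → Fin n → ℝ)
    (ha : LinearIndependent ℝ fun i => fun k : {k : Fin n // k ≠ ⟨0, hn⟩} => a i k) :
    Function.Surjective
      ((ContinuousLinearMap.proj (R := ℝ) (φ := fun _ : Fin n => ℝ) ⟨0, hn⟩).prod
        (ContinuousLinearMap.pi fun i => ∑ k, a i k • ContinuousLinearMap.proj k)) := by
  intro b
  obtain ⟨w, hw⟩ := Matrix.mulVec_surjective_of_linearIndependent_row
    (A := Matrix.of fun i (k : {k : Fin n // k ≠ ⟨0, hn⟩}) => a i k) ha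
    (fun i => b.2 i - a i ⟨0, hn⟩ * b.1)
  refine ⟨fun k => if hk : k = ⟨0, hn⟩ then b.1 else w ⟨k, hk⟩,
    Prod.ext (by simp) (funext fun i => ?_)⟩
  have hwi : ∑ k : {k : Fin n // k ≠ ⟨0, hn⟩}, a i k * w k = b.2 i - a i ⟨0, hn⟩ * b.1 :=
    congrFun hw i
  simp only [ContinuousLinearMap.prod_apply, ContinuousLinearMap.pi_apply,
    sum_apply, smul_apply, ContinuousLinearMap.proj_apply,
    smul_eq_mul]
  rw [Fintype.sum_eq_add_sum_subtype_ne _ ⟨0, hn⟩]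
  simp only [dif_pos]
  rw [← eq_sub_iff_add_eq', ← hwi]
  exact Finset.sum_congr rfl fun k _ => by rw [dif_neg k.2]

theorem statement2 (n m : ℕ) (hn : 0 < n) (f : Fin m → MvPolynomial (Fin n) ℝ)
    (σ : Fin m → Sign5)
    (x₀ : Fin n → ℝ) (hx₀ : x₀ ∈ {x : Fin n → ℝ | ∀ i, (σ i).holds (eval x (f i))})
    (C : Set (Fin n → ℝ))
    (hC : C = connectedComponentIn {x : Fin n → ℝ | ∀ i, (σ i).holds (eval x (f i))} x₀)
    (z : Fin n → ℝ) (hz : z ∈ ZZ hn C) :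
    (∃ i : Fin m, eval z (f i) = 0) ∧
    (∀ i : Fin m, σ i = Sign5.eq → eval z (f i) = 0) ∧
    ({i : Fin m | eval z (f i) = 0}.ncard ≤ n - 1 →
      ¬ LinearIndependent ℝ
        (fun i : {i : Fin m // eval z (f i) = 0} =>
          fun k : {k : Fin n // k ≠ ⟨0, hn⟩} => eval z (pderiv k.1 (f i.1)))) := by
  classical
  set S := {x : Fin n → ℝ | ∀ i, (σ i).holds (eval x (f i))}
  have hzC : z ∈ closure C := hz.elim And.left And.left
  have hcont (i : Fin m) : Continuous fun x : Fin n → ℝ => eval x (f i) :=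
    MvPolynomial.continuous_eval (f i)
  have hsign (i : Fin m) : eval z (f i) ∈ closure {t | (σ i).holds t} :=
    map_mem_closure (f := fun x => eval x (f i)) (hcont i) hzC fun x hx => by
      rw [hC] at hx
      exact connectedComponentIn_subset S x₀ hx i
  have hdep : ¬ LinearIndependent ℝ
      (fun i : {i : Fin m // eval z (f i) = 0} =>
        fun k : {k : Fin n // k ≠ ⟨0, hn⟩} => eval z (pderiv k.1 (f i.1))) := by
    intro hli
    refine notMem_ZZ_of_eventually ?_ hz
    have hG := (hasStrictFDerivAt_apply (𝕜 := ℝ) (⟨0, hn⟩ : Fin n) z).prodMk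
      (hasStrictFDerivAt_pi.mpr fun i : {i : Fin m // eval z (f i) = 0} =>
        MvPolynomial.hasStrictFDerivAt_eval (f i) z)
    rw [hC] at hzC ⊢
    refine HasStrictFDerivAt.eventually_exists_mem_connectedComponentIn (E := Fin n → ℝ)
      (F := {i : Fin m // eval z (f i) = 0} → ℝ) (S := S)
      (U := {x | ∀ i, eval z (f i) ≠ 0 → (σ i).holds (eval x (f i))})
      (Q := Set.pi univ fun i => {t | (σ i).holds t})
      hG (surjective_proj_prod_of_linearIndependent hn _ hli)
      (convex_pi fun i _ => (σ i).convex_holds) ?_ (fun x hx i _ => hx i) ?_ hzC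
    · refine Filter.eventually_all.mpr fun i => ?_
      by_cases hi : eval z (f i) = 0
      · exact Filter.Eventually.of_forall fun x h => absurd hi h
      · exact ((hcont i).continuousAt.eventually
          (Sign5.eventually_holds_of_ne_zero hi (hsign i))).mono fun x hx _ => hx
    · intro x hxU hxQ i
      by_cases hi : eval z (f i) = 0
      · exact hxQ ⟨i, hi⟩ (mem_univ _)
      · exact hxU i hi
  refine ⟨?_, fun i hi => ?_, fun _ => hdep⟩
  · by_contra! hne
    have : IsEmpty {i : Fin m // eval z (f i) = 0} := ⟨fun i => hne i i.2⟩
    exact hdep linearIndependent_empty_type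
  · have hzi := hsign i
    rw [hi] at hzi
    exact isClosed_singleton.closure_subset hzi
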